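/- Two holomorphic local dynamical systems at 0 ∈ ℂ, each with a hyperbolic fixed point at the origin (multiplier nonzero and of modulus different from 1), are holomorphically locally conjugated if and only if they have the same multiplier. -/

import Mathlib

open Set Filter Topology

/-- `φ` is a biholomorphism from `W₁` onto `W₂` fixing `0` which conjugates the holomorphic
local dynamical system `f₁` (defined on `U₁`) to `f₂` (defined on `U₂`). -/
def IsHolConjVia (f₁ : ℂ → ℂ) (U₁ : Set ℂ) (f₂ : ℂ → ℂ) (U₂ : Set ℂ)
    (φ : ℂ → ℂ) (W₁ W₂ : Set ℂ) : Prop :=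
  IsOpen W₁ ∧ IsOpen W₂ ∧ (0 : ℂ) ∈ W₁ ∧ (0 : ℂ) ∈ W₂ ∧ W₁ ⊆ U₁ ∧ W₂ ⊆ U₂ ∧
    DifferentiableOn ℂ φ W₁ ∧ Set.BijOn φ W₁ W₂ ∧
    (∃ ψ : ℂ → ℂ, DifferentiableOn ℂ ψ W₂ ∧ Set.EqOn (ψ ∘ φ) id W₁) ∧
    φ 0 = 0 ∧ ∀ z ∈ W₁, f₁ z ∈ W₁ → φ (f₁ z) = f₂ (φ z)

/-- `f₁` and `f₂` are holomorphically locally conjugated at `0`. -/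
def HolLocallyConj (f₁ : ℂ → ℂ) (U₁ : Set ℂ) (f₂ : ℂ → ℂ) (U₂ : Set ℂ) : Prop :=
  ∃ φ W₁ W₂, IsHolConjVia f₁ U₁ f₂ U₂ φ W₁ W₂

/-- A holomorphic germ at a fixed point with nonzero multiplier has a holomorphic inverse germ. -/
theorem AnalyticAt.exists_inverse_germ {f : ℂ → ℂ} (hf : AnalyticAt ℂ f 0) (hf0 : f 0 = 0)
    (hd : deriv f 0 ≠ 0) :
    ∃ g : ℂ → ℂ, AnalyticAt ℂ g 0 ∧ g 0 = 0 ∧ deriv g 0 = (deriv f 0)⁻¹ ∧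
      (∀ᶠ z in 𝓝 0, g (f z) = z) ∧ ∀ᶠ z in 𝓝 0, f (g z) = z := by
  have hs := hf.hasStrictDerivAt
  have hE := hs.hasStrictFDerivAt_equiv hd
  have hl : ∀ᶠ z in 𝓝 0, hs.localInverse f _ 0 hd (f z) = z := hE.eventually_left_inverse
  have hr : ∀ᶠ z in 𝓝 (f 0), f (hs.localInverse f _ 0 hd z) = z := hE.eventually_right_inverse
  have h0 : hs.localInverse f _ 0 hd (f 0) = 0 := hE.localInverse_apply_image
  have hD := (hs.to_localInverse hd).hasDerivAt.deriv
  have hA := hf.analyticAt_localInverse hd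
  rw [hf0] at hr h0 hD hA
  exact ⟨_, hA, h0, hD, hl, hr⟩

/-- Kœnigs linearization of a holomorphic germ with an attracting, not superattracting,
fixed point. -/
theorem AnalyticAt.exists_linearization_of_norm_lt_one {f : ℂ → ℂ} (hf : AnalyticAt ℂ f 0)
    (hf0 : f 0 = 0) (hd : deriv f 0 ≠ 0) (hlt : ‖deriv f 0‖ < 1) :
    ∃ h : ℂ → ℂ, AnalyticAt ℂ h 0 ∧ h 0 = 0 ∧ deriv h 0 = 1 ∧
      ∀ᶠ z in 𝓝 0, h (f z) = deriv f 0 * h z := by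
  set l := deriv f 0
  have hlpos : 0 < ‖l‖ := norm_pos_iff.2 hd
  obtain ⟨c, hlc, hcs⟩ : ∃ c, ‖l‖ < c ∧ c < √‖l‖ :=
    exists_between (Real.lt_sqrt_of_sq_lt (by nlinarith))
  have hc0 : 0 < c := hlpos.trans hlc
  have hc2 : c ^ 2 < ‖l‖ := (Real.lt_sqrt hc0.le).1 hcs
  have hc1 : c < 1 := by nlinarith
  have hq : c ^ 2 / ‖l‖ < 1 := (div_lt_one hlpos).2 hc2
  have hmul : ∀ z, f z = z * dslope f 0 z := fun z => by
    simpa [hf0] using (sub_smul_dslope f 0 z).symm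
  have hfd : ∀ᶠ z in 𝓝 0, DifferentiableAt ℂ f z :=
    hf.eventually_analyticAt.mono fun z hz => hz.differentiableAt
  have hgd : DifferentiableAt ℂ (dslope f 0) 0 := by
    obtain ⟨t, ht, hto, h0t⟩ := eventually_nhds_iff.1 hfd
    have htn : t ∈ 𝓝 (0 : ℂ) := hto.mem_nhds h0t
    exact ((Complex.differentiableOn_dslope htn).2
      fun z hz => (ht z hz).differentiableWithinAt).differentiableAt htn
  have hg0 : dslope f 0 0 = l := dslope_same f 0
  have hgc : ∀ᶠ z in 𝓝 0, ‖dslope f 0 z‖ < c :=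
    hgd.continuousAt.norm.eventually_lt continuousAt_const (by simpa [hg0] using hlc)
  obtain ⟨C, hC0, hC⟩ := hgd.isBigO_sub.exists_pos
  obtain ⟨r, hr, hball⟩ := Metric.eventually_nhds_iff_ball.1 (hfd.and (hgc.and hC.bound))
  set B := Metric.ball (0 : ℂ) r with hB
  have hBo : IsOpen B := Metric.isOpen_ball
  have h0B : (0 : ℂ) ∈ B := Metric.mem_ball_self hr
  have hfc : ∀ z ∈ B, ‖f z‖ ≤ c * ‖z‖ := fun z hz => by
    rw [hmul z, norm_mul, mul_comm]
    exact mul_le_mul_of_nonneg_right (hball z hz).2.1.le (norm_nonneg _)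
  have hfq : ∀ z ∈ B, ‖f z - l * z‖ ≤ C * ‖z‖ ^ 2 := fun z hz => by
    have h := (hball z hz).2.2
    rw [hg0, sub_zero] at h
    calc ‖f z - l * z‖ = ‖z‖ * ‖dslope f 0 z - l‖ := by rw [← norm_mul, hmul z]; ring_nf
      _ ≤ ‖z‖ * (C * ‖z‖) := mul_le_mul_of_nonneg_left h (norm_nonneg _)
      _ = C * ‖z‖ ^ 2 := by ring
  have hmaps : MapsTo f B B := fun z hz => by
    have h := hfc z hz
    rw [hB, mem_ball_zero_iff] at hz ⊢
    nlinarith [norm_nonneg z]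
  have hit : ∀ n, ∀ z ∈ B, ‖f^[n] z‖ ≤ c ^ n * ‖z‖ := by
    intro n z hz
    induction n with
    | zero => simp
    | succ n ih =>
      rw [Function.iterate_succ_apply', pow_succ']
      calc _ ≤ c * ‖f^[n] z‖ := hfc _ (hmaps.iterate n hz)
        _ ≤ c * (c ^ n * ‖z‖) := mul_le_mul_of_nonneg_left ih hc0.le
        _ = _ := by ring
  have hfB : DifferentiableOn ℂ f B := fun z hz => (hball z hz).1.differentiableWithinAt
  let t : ℕ → ℂ → ℂ := fun n z => (l ^ (n + 1))⁻¹ * (f^[n + 1] z - l * f^[n] z)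
  have ht : ∀ n, ∀ z ∈ B, ‖t n z‖ ≤ (C / ‖l‖) * ‖z‖ ^ 2 * (c ^ 2 / ‖l‖) ^ n := fun n z hz => by
    have h1 := hfq _ (hmaps.iterate n hz)
    have h2 : ‖f^[n] z‖ ^ 2 ≤ (c ^ n * ‖z‖) ^ 2 :=
      pow_le_pow_left₀ (norm_nonneg _) (hit n z hz) 2
    simp only [t]
    rw [norm_mul, norm_inv, norm_pow, Function.iterate_succ_apply']
    calc _ ≤ (‖l‖ ^ (n + 1))⁻¹ * (C * (c ^ n * ‖z‖) ^ 2) := by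
          refine mul_le_mul_of_nonneg_left (h1.trans ?_) (by positivity)
          exact mul_le_mul_of_nonneg_left h2 hC0.le
      _ = _ := by
          rw [div_pow]
          field_simp
          ring
  have hgeo := summable_geometric_of_lt_one (by positivity : 0 ≤ c ^ 2 / ‖l‖) hq
  have htB : DifferentiableOn ℂ (fun z => ∑' n, t n z) B := by
    refine Complex.differentiableOn_tsum_of_summable_norm
      (u := fun n => (C / ‖l‖) * r ^ 2 * (c ^ 2 / ‖l‖) ^ n) (hgeo.mul_left _) ?_ hBo ?_
    · intro n
      exact ((hfB.iterate hmaps (n + 1)).sub ((hfB.iterate hmaps n).const_mul l)).const_mul _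
    · intro n z hz
      refine (ht n z hz).trans ?_
      have : ‖z‖ ≤ r := (mem_ball_zero_iff.1 hz).le
      gcongr
  have hsum : ∀ z ∈ B, Summable fun n => t n z := fun z hz =>
    Summable.of_norm_bounded (hgeo.mul_left _) fun n => ht n z hz
  have hbd : ∀ z ∈ B, ‖∑' n, t n z‖ ≤ (C / ‖l‖) * ‖z‖ ^ 2 * (1 - c ^ 2 / ‖l‖)⁻¹ := fun z hz =>
    tsum_of_norm_bounded
      ((hasSum_geometric_of_lt_one (by positivity) hq).mul_left _) fun n => ht n z hz
  have hpart : ∀ z n, ∑ k ∈ Finset.range n, t k z = (l ^ n)⁻¹ * f^[n] z - z := by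
    intro z n
    induction n with
    | zero => simp
    | succ n ih =>
      rw [Finset.sum_range_succ, ih]
      simp only [t]
      field_simp
      ring
  have hlim : ∀ z ∈ B, Tendsto (fun n => (l ^ n)⁻¹ * f^[n] z) atTop (𝓝 (z + ∑' n, t n z)) := by
    intro z hz
    have h := (hsum z hz).hasSum.tendsto_sum_nat.const_add z
    simpa [hpart] using h
  have hsum0 : ∑' n, t n 0 = 0 := by simpa using hbd 0 h0B
  have hsumD : HasDerivAt (fun z => ∑' n, t n z) 0 0 := by
    rw [hasDerivAt_iff_isLittleO]
    simp only [hsum0, sub_zero, smul_zero]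
    have h1 : (fun z => ∑' n, t n z) =O[𝓝 0] fun z : ℂ => z ^ 2 := by
      refine Asymptotics.IsBigO.of_bound ((C / ‖l‖) * (1 - c ^ 2 / ‖l‖)⁻¹) ?_
      filter_upwards [hBo.mem_nhds h0B] with z hz
      rw [norm_pow]
      exact (hbd z hz).trans_eq (by ring)
    exact h1.trans_isLittleO (Asymptotics.isLittleO_pow_id one_lt_two)
  refine ⟨fun z => z + ∑' n, t n z, ?_, by simp [hsum0], ?_, ?_⟩
  · exact (differentiableOn_id.add htB).analyticAt (hBo.mem_nhds h0B)
  · exact ((hasDerivAt_id (0 : ℂ)).add hsumD).deriv.trans (add_zero 1)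
  · filter_upwards [hBo.mem_nhds h0B] with z hz
    refine tendsto_nhds_unique (hlim _ (hmaps hz)) ?_
    have h := ((hlim z hz).comp (tendsto_add_atTop_nat 1)).const_mul l
    refine h.congr fun n => ?_
    simp only [Function.comp_apply, Function.iterate_succ_apply]
    field_simp
    ring

/-- **Kœnigs linearization** of a holomorphic germ at a hyperbolic fixed point. -/
theorem AnalyticAt.exists_linearization {f : ℂ → ℂ} (hf : AnalyticAt ℂ f 0)
    (hf0 : f 0 = 0) (hd : deriv f 0 ≠ 0) (hne : ‖deriv f 0‖ ≠ 1) :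
    ∃ h : ℂ → ℂ, AnalyticAt ℂ h 0 ∧ h 0 = 0 ∧ deriv h 0 = 1 ∧
      ∀ᶠ z in 𝓝 0, h (f z) = deriv f 0 * h z := by
  rcases hne.lt_or_gt with hlt | hgt
  · exact hf.exists_linearization_of_norm_lt_one hf0 hd hlt
  obtain ⟨g, hg, hg0, hgd, hgf, -⟩ := hf.exists_inverse_germ hf0 hd
  obtain ⟨h, hh, hh0, hhd, hconj⟩ := hg.exists_linearization_of_norm_lt_one hg0
    (by simpa [hgd] using hd) (by rw [hgd, norm_inv]; exact inv_lt_one_of_one_lt₀ hgt)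
  refine ⟨h, hh, hh0, hhd, ?_⟩
  have hft : Tendsto f (𝓝 0) (𝓝 0) := by simpa [hf0] using hf.continuousAt.tendsto
  filter_upwards [hft.eventually hconj, hgf] with z h1 h2
  rw [h2, hgd] at h1
  rw [h1, mul_inv_cancel_left₀ hd]

/-- Germs of holomorphic maps with a hyperbolic fixed point and the same multiplier are
conjugated by a germ tangent to the identity. -/
theorem AnalyticAt.exists_conj_germ {f₁ f₂ : ℂ → ℂ} (hf₁ : AnalyticAt ℂ f₁ 0)
    (hf₂ : AnalyticAt ℂ f₂ 0) (h₁ : f₁ 0 = 0) (h₂ : f₂ 0 = 0) (heq : deriv f₁ 0 = deriv f₂ 0)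
    (hd : deriv f₁ 0 ≠ 0) (hne : ‖deriv f₁ 0‖ ≠ 1) :
    ∃ φ : ℂ → ℂ, AnalyticAt ℂ φ 0 ∧ φ 0 = 0 ∧ deriv φ 0 = 1 ∧
      ∀ᶠ z in 𝓝 0, φ (f₁ z) = f₂ (φ z) := by
  obtain ⟨a, ha, ha0, had, haf⟩ := hf₁.exists_linearization h₁ hd hne
  obtain ⟨b, hb, hb0, hbd, hbf⟩ := hf₂.exists_linearization h₂ (heq ▸ hd) (heq ▸ hne)
  obtain ⟨g, hg, hg0, hgd, hgb, hbg⟩ := hb.exists_inverse_germ hb0 (by simp [hbd])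
  have hg' : AnalyticAt ℂ g (a 0) := by rwa [ha0]
  have hφ : AnalyticAt ℂ (g ∘ a) 0 := hg'.comp ha
  have hφ0 : (g ∘ a) 0 = 0 := by simp [ha0, hg0]
  have hat : Tendsto a (𝓝 0) (𝓝 0) := by simpa [ha0] using ha.continuousAt.tendsto
  have hφt : Tendsto (g ∘ a) (𝓝 0) (𝓝 0) := by
    simpa only [hφ0] using hφ.continuousAt.tendsto
  have hft : Tendsto f₂ (𝓝 0) (𝓝 0) := by simpa [h₂] using hf₂.continuousAt.tendsto
  refine ⟨g ∘ a, hφ, hφ0, ?_, ?_⟩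
  · rw [deriv_comp 0 hg'.differentiableAt ha.differentiableAt, ha0, hgd, hbd, had]
    simp
  · filter_upwards [haf, hφt.eventually hbf, hat.eventually hbg,
      (hft.comp hφt).eventually hgb] with z e1 e2 e3 e4
    simp only [Function.comp_apply] at *
    rw [e1, ← e4, e2, e3, heq]

/-- **Kœnigs' theorem, part (ii).** Two one-dimensional holomorphic local dynamical systems with
hyperbolic fixed points at the origin are holomorphically locally conjugated if and only if they
have the same multiplier. -/
theorem hyperbolic_holConj_iff_same_multiplier
    (f₁ f₂ : ℂ → ℂ) (U₁ U₂ : Set ℂ)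
    (hU₁ : IsOpen U₁) (h0₁ : (0 : ℂ) ∈ U₁) (hf₁ : DifferentiableOn ℂ f₁ U₁)
    (hf₁0 : f₁ 0 = 0) (hf₁ne : ∃ z ∈ U₁, f₁ z ≠ z)
    (hU₂ : IsOpen U₂) (h0₂ : (0 : ℂ) ∈ U₂) (hf₂ : DifferentiableOn ℂ f₂ U₂)
    (hf₂0 : f₂ 0 = 0) (hf₂ne : ∃ z ∈ U₂, f₂ z ≠ z)
    (h₁0 : deriv f₁ 0 ≠ 0) (h₁1 : ‖deriv f₁ 0‖ ≠ 1)
    (h₂0 : deriv f₂ 0 ≠ 0) (h₂1 : ‖deriv f₂ 0‖ ≠ 1) :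
    HolLocallyConj f₁ U₁ f₂ U₂ ↔ deriv f₁ 0 = deriv f₂ 0 := by
  have hA₁ : AnalyticAt ℂ f₁ 0 := hf₁.analyticAt (hU₁.mem_nhds h0₁)
  have hA₂ : AnalyticAt ℂ f₂ 0 := hf₂.analyticAt (hU₂.mem_nhds h0₂)
  constructor
  · rintro ⟨φ, W₁, W₂, hW₁, hW₂, h0W₁, h0W₂, -, -, hφ, -, ⟨ψ, hψ, hψφ⟩, hφ0, hconj⟩
    have hφd : HasDerivAt φ (deriv φ 0) 0 := (hφ.differentiableAt (hW₁.mem_nhds h0W₁)).hasDerivAt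
    have hψd : HasDerivAt ψ (deriv ψ 0) (φ 0) := by
      rw [hφ0]
      exact (hψ.differentiableAt (hW₂.mem_nhds h0W₂)).hasDerivAt
    have hφne : deriv φ 0 ≠ 0 := by
      have hid : ψ ∘ φ =ᶠ[𝓝 0] id := hψφ.eventuallyEq_of_mem (hW₁.mem_nhds h0W₁)
      have h := (hψd.comp 0 hφd).unique ((hasDerivAt_id (0 : ℂ)).congr_of_eventuallyEq hid)
      exact right_ne_zero_of_mul_eq_one h
    have hev : φ ∘ f₁ =ᶠ[𝓝 0] f₂ ∘ φ := by
      have hpre : f₁ ⁻¹' W₁ ∈ 𝓝 0 :=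
        hA₁.continuousAt.preimage_mem_nhds (by simpa [hf₁0] using hW₁.mem_nhds h0W₁)
      filter_upwards [hW₁.mem_nhds h0W₁, hpre] with z hz hz'
      exact hconj z hz hz'
    have hl : HasDerivAt (φ ∘ f₁) (deriv φ 0 * deriv f₁ 0) 0 :=
      HasDerivAt.comp 0 (by rwa [hf₁0]) hA₁.differentiableAt.hasDerivAt
    have hr : HasDerivAt (f₂ ∘ φ) (deriv f₂ 0 * deriv φ 0) 0 :=
      HasDerivAt.comp 0 (by rw [hφ0]; exact hA₂.differentiableAt.hasDerivAt) hφd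
    have h := hl.unique (hr.congr_of_eventuallyEq hev)
    rw [mul_comm] at h
    exact mul_right_cancel₀ hφne h
  · intro heq
    obtain ⟨φ, hφ, hφ0, hφd, hconj⟩ := hA₁.exists_conj_germ hA₂ hf₁0 hf₂0 heq h₁0 h₁1
    obtain ⟨ψ, hψ, hψ0, -, hψφ, hφψ⟩ := hφ.exists_inverse_germ hφ0 (by simp [hφd])
    have hφU : ∀ᶠ z in 𝓝 0, φ z ∈ U₂ :=
      hφ.continuousAt.preimage_mem_nhds (by simpa [hφ0] using hU₂.mem_nhds h0₂)
    obtain ⟨A, hA, hAo, h0A⟩ := eventually_nhds_iff.1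
      ((hφ.eventually_analyticAt.and (hU₁.mem_nhds h0₁)).and (hφU.and (hψφ.and hconj)))
    obtain ⟨B, hB, hBo, h0B⟩ := eventually_nhds_iff.1
      ((hψ.eventually_analyticAt.and (hU₂.mem_nhds h0₂)).and hφψ)
    have hφA : DifferentiableOn ℂ φ A :=
      fun z hz => (hA z hz).1.1.differentiableAt.differentiableWithinAt
    have hψB : DifferentiableOn ℂ ψ B :=
      fun z hz => (hB z hz).1.1.differentiableAt.differentiableWithinAt
    have hleft : ∀ z ∈ A, ψ (φ z) = z := fun z hz => (hA z hz).2.2.1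
    have hright : ∀ w ∈ B, φ (ψ w) = w := fun w hw => (hB w hw).2
    refine ⟨φ, A ∩ φ ⁻¹' B, B ∩ ψ ⁻¹' A, hφA.continuousOn.isOpen_inter_preimage hAo hBo,
      hψB.continuousOn.isOpen_inter_preimage hBo hAo, ⟨h0A, by simpa [hφ0] using h0B⟩,
      ⟨h0B, by simpa [hψ0] using h0A⟩, fun z hz => (hA z hz.1).1.2,
      fun w hw => (hB w hw.1).1.2, hφA.mono inter_subset_left, ⟨?_, ?_, ?_⟩,
      ⟨ψ, hψB.mono inter_subset_left, fun z hz => hleft z hz.1⟩, hφ0,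
      fun z hz _ => (hA z hz.1).2.2.2⟩
    · intro z hz
      exact ⟨hz.2, by simpa [hleft z hz.1] using hz.1⟩
    · intro z hz w hw h
      rw [← hleft z hz.1, h, hleft w hw.1]
    · intro w hw
      exact ⟨ψ w, ⟨hw.2, by simpa [hright w hw.1] using hw.1⟩, hright w hw.1⟩
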